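/- Suppose the grid functions hⁿ, hⁿ⁺¹, uⁿ, uⁿ⁺¹, vⁿ, vⁿ⁺¹, b together with constants g > 0, ω ∈ ℝ, Δt > 0, η > 0 satisfy the finite volume scheme with stabilisation terms qⁿ⁺¹_{i,j} = ηΔt(∂xφⁿ⁺¹_{i,j} − ω vⁿ_{i,j}) and rⁿ⁺¹_{i,j} = ηΔt(∂yφⁿ⁺¹_{i,j} + ω uⁿ_{i,j}), that (Δt/Δx)|uⁿ_{i,j}| < 1/2 and (Δt/Δy)|vⁿ_{i,j}| < 1/2 for all (i,j), and that the data at time level n is at the discrete geostrophic jet steady state: uⁿ_{i,j} = 0 for all (i,j); hⁿ_{i,j}, vⁿ_{i,j} and b_{i,j} are independent of j (i.e. hⁿ_{i,j+1} = hⁿ_{i,j}, vⁿ_{i,j+1} = vⁿ_{i,j}, b_{i,j+1} = b_{i,j} for all (i,j)); and ∂xφⁿ_{i,j} − ω vⁿ_{i,j} = 0 for all (i,j), where φⁿ = g(hⁿ + b). Then the updated solution coincides with the data: hⁿ⁺¹_{i,j} = hⁿ_{i,j}, uⁿ⁺¹_{i,j} = uⁿ_{i,j} = 0 and vⁿ⁺¹_{i,j}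 = vⁿ_{i,j} for all (i,j); in particular hⁿ⁺¹ and vⁿ⁺¹ are independent of j and ∂xφⁿ⁺¹_{i,j} − ω vⁿ⁺¹_{i,j} = 0 for all (i,j). -/

import Mathlib

/-- Cell indices of a uniform periodic grid with `Nx × Ny` cells. -/
abbrev Idx (Nx Ny : ℕ) := ZMod Nx × ZMod Ny

/-- A grid function on a uniform periodic grid with `Nx × Ny` cells. -/
abbrev Grid (Nx Ny : ℕ) := Idx Nx Ny → ℝ

variable {Nx Ny : ℕ}

/-- Shift the index one cell in the positive `x` direction. -/
def shXp (p : Idx Nx Ny) : Idx Nx Ny := (p.1 + 1, p.2)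

/-- Shift the index one cell in the negative `x` direction. -/
def shXm (p : Idx Nx Ny) : Idx Nx Ny := (p.1 - 1, p.2)

/-- Shift the index one cell in the positive `y` direction. -/
def shYp (p : Idx Nx Ny) : Idx Nx Ny := (p.1, p.2 + 1)

/-- Shift the index one cell in the negative `y` direction. -/
def shYm (p : Idx Nx Ny) : Idx Nx Ny := (p.1, p.2 - 1)

/-- Central discrete derivative in `x`: `(z_{i+1,j} − z_{i−1,j})/(2Δx)`. -/
noncomputable def dX (Δx : ℝ) (z : Grid Nx Ny) : Grid Nx Ny :=
  fun p => (z (shXp p) - z (shXm p)) / (2 * Δx)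

/-- Central discrete derivative in `y`: `(z_{i,j+1} − z_{i,j−1})/(2Δy)`. -/
noncomputable def dY (Δy : ℝ) (z : Grid Nx Ny) : Grid Nx Ny :=
  fun p => (z (shYp p) - z (shYm p)) / (2 * Δy)

/-- Average of a grid function at the vertical edge `(i+1/2, j)`. -/
noncomputable def avgX (z : Grid Nx Ny) : Grid Nx Ny := fun p => (z p + z (shXp p)) / 2

/-- Average of a grid function at the horizontal edge `(i, j+1/2)`. -/
noncomputable def avgY (z : Grid Nx Ny) : Grid Nx Ny := fun p => (z p + z (shYp p)) / 2

/-- Numerical mass flux `F^{n+1}_{i+1/2,j} = {{h^{n+1}u^n}}_{i+1/2,j} − {{q^{n+1}}}_{i+1/2,j}`. -/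
noncomputable def fluxF (h1 u0 q1 : Grid Nx Ny) : Grid Nx Ny :=
  fun p => avgX (fun s => h1 s * u0 s) p - avgX q1 p

/-- Numerical mass flux `G^{n+1}_{i,j+1/2} = {{h^{n+1}v^n}}_{i,j+1/2} − {{r^{n+1}}}_{i,j+1/2}`. -/
noncomputable def fluxG (h1 v0 r1 : Grid Nx Ny) : Grid Nx Ny :=
  fun p => avgY (fun s => h1 s * v0 s) p - avgY r1 p

/-- Upwind edge value at a vertical edge with respect to the flux `F`. -/
noncomputable def upX (F w : Grid Nx Ny) : Grid Nx Ny :=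
  fun p => if 0 ≤ F p then w p else w (shXp p)

/-- Upwind edge value at a horizontal edge with respect to the flux `G`. -/
noncomputable def upY (G w : Grid Nx Ny) : Grid Nx Ny :=
  fun p => if 0 ≤ G p then w p else w (shYp p)

/-- The semi-implicit finite volume scheme for the rotating shallow water system:
mass balance and both momentum balances, relating the solution `(h0, u0, v0)` at
time level `n` to the solution `(h1, u1, v1)` at time level `n+1`, with bottom
topography `b` and stabilisation terms `q1`, `r1`. -/
def Scheme (Δx Δy Δt g ω : ℝ) (h0 h1 u0 u1 v0 v1 b q1 r1 : Grid Nx Ny) : Prop :=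
  (∀ p : Idx Nx Ny,
    (h1 p - h0 p) / Δt
      + (fluxF h1 u0 q1 p - fluxF h1 u0 q1 (shXm p)) / Δx
      + (fluxG h1 v0 r1 p - fluxG h1 v0 r1 (shYm p)) / Δy = 0) ∧
  (∀ p : Idx Nx Ny,
    (h1 p * u1 p - h0 p * u0 p) / Δt
      + (fluxF h1 u0 q1 p * upX (fluxF h1 u0 q1) u0 p
          - fluxF h1 u0 q1 (shXm p) * upX (fluxF h1 u0 q1) u0 (shXm p)) / Δx
      + (fluxG h1 v0 r1 p * upY (fluxG h1 v0 r1) u0 p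
          - fluxG h1 v0 r1 (shYm p) * upY (fluxG h1 v0 r1) u0 (shYm p)) / Δy
      + h1 p * dX Δx (fun s => g * (h1 s + b s)) p
      = ω * h1 p * v0 p - ω * r1 p) ∧
  (∀ p : Idx Nx Ny,
    (h1 p * v1 p - h0 p * v0 p) / Δt
      + (fluxF h1 u0 q1 p * upX (fluxF h1 u0 q1) v0 p
          - fluxF h1 u0 q1 (shXm p) * upX (fluxF h1 u0 q1) v0 (shXm p)) / Δx
      + (fluxG h1 v0 r1 p * upY (fluxG h1 v0 r1) v0 p
          - fluxG h1 v0 r1 (shYm p) * upY (fluxG h1 v0 r1) v0 (shYm p)) / Δy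
      + h1 p * dY Δy (fun s => g * (h1 s + b s)) p
      = -(ω * h1 p * u0 p) + ω * q1 p)

@[simp] lemma shXp_shXm (p : Idx Nx Ny) : shXp (shXm p) = p := by simp [shXp, shXm]

@[simp] lemma shXm_shXp (p : Idx Nx Ny) : shXm (shXp p) = p := by simp [shXp, shXm]

@[simp] lemma shYp_shYm (p : Idx Nx Ny) : shYp (shYm p) = p := by simp [shYp, shYm]

@[simp] lemma shYm_shYp (p : Idx Nx Ny) : shYm (shYp p) = p := by simp [shYp, shYm]

lemma sum_comp_shXp [NeZero Nx] [NeZero Ny] (f : Grid Nx Ny) :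
    ∑ p, f (shXp p) = ∑ p, f p :=
  Equiv.sum_comp ⟨shXp, shXm, shXm_shXp, shXp_shXm⟩ f

lemma sum_comp_shYp [NeZero Nx] [NeZero Ny] (f : Grid Nx Ny) :
    ∑ p, f (shYp p) = ∑ p, f p :=
  Equiv.sum_comp ⟨shYp, shYm, shYm_shYp, shYp_shYm⟩ f

/-- Summation by parts for the central difference in `x`. -/
lemma sum_mul_dX [NeZero Nx] [NeZero Ny] (Δx : ℝ) (a z : Grid Nx Ny) :
    ∑ p, a p * dX Δx z p = -∑ p, dX Δx a p * z p := by
  have e₁ := sum_comp_shXp fun p => a (shXm p) * z p / (2 * Δx)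
  have e₂ := sum_comp_shXp fun p => a p * z (shXm p) / (2 * Δx)
  simp only [shXm_shXp] at e₁ e₂
  simp only [dX, mul_div_assoc', mul_sub, sub_mul, sub_div, div_mul_eq_mul_div,
    Finset.sum_sub_distrib]
  linarith

/-- Summation by parts for the central difference in `y`. -/
lemma sum_mul_dY [NeZero Nx] [NeZero Ny] (Δy : ℝ) (a z : Grid Nx Ny) :
    ∑ p, a p * dY Δy z p = -∑ p, dY Δy a p * z p := by
  have e₁ := sum_comp_shYp fun p => a (shYm p) * z p / (2 * Δy)
  have e₂ := sum_comp_shYp fun p => a p * z (shYm p) / (2 * Δy)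
  simp only [shYm_shYp] at e₁ e₂
  simp only [dY, mul_div_assoc', mul_sub, sub_mul, sub_div, div_mul_eq_mul_div,
    Finset.sum_sub_distrib]
  linarith

/-- A discrete implicit advection-diffusion step along `y`-independent transport
has only the trivial solution for zero data. -/
lemma eq_zero_of_advection_diffusion [NeZero Nx] [NeZero Ny] {Δx Δy Δt c : ℝ}
    (hΔt : 0 < Δt) (hc : 0 ≤ c) {d v : Grid Nx Ny}
    (hv : ∀ p, v (shYp p) = v p)
    (hd : ∀ p, d p / Δt - c * dX Δx (dX Δx d) p
      + (v p * dY Δy d p - c * dY Δy (dY Δy d) p) = 0) (p : Idx Nx Ny) :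
    d p = 0 := by
  have hv' : ∀ p, v (shYm p) = v p := fun p => by simpa using (hv (shYm p)).symm
  have hx := sum_mul_dX Δx d (dX Δx d)
  have hy := sum_mul_dY Δy d (dY Δy d)
  have hskew : ∑ p, v p * d p * dY Δy d p = 0 := by
    have h := sum_mul_dY Δy (fun p => v p * d p) d
    have h' : ∑ p, dY Δy (fun p => v p * d p) p * d p = ∑ p, v p * d p * dY Δy d p :=
      Finset.sum_congr rfl fun p _ => by simp only [dY, hv, hv']; ring
    linarith
  have henergy : (∑ p, d p * d p) / Δt + c * ∑ p, dX Δx d p * dX Δx d p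
      + c * ∑ p, dY Δy d p * dY Δy d p = 0 := by
    have h : ∑ p, (d p * d p / Δt - c * (d p * dX Δx (dX Δx d) p)
        + (v p * d p * dY Δy d p - c * (d p * dY Δy (dY Δy d) p))) = 0 :=
      Finset.sum_eq_zero fun p _ => by linear_combination d p * hd p
    rw [Finset.sum_add_distrib, Finset.sum_sub_distrib, Finset.sum_sub_distrib,
      ← Finset.sum_div, ← Finset.mul_sum, ← Finset.mul_sum, hskew, hx, hy] at h
    linarith
  have hX : 0 ≤ c * ∑ p, dX Δx d p * dX Δx d p :=
    mul_nonneg hc (Finset.sum_nonneg fun p _ => mul_self_nonneg _)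
  have hY : 0 ≤ c * ∑ p, dY Δy d p * dY Δy d p :=
    mul_nonneg hc (Finset.sum_nonneg fun p _ => mul_self_nonneg _)
  have hD : 0 ≤ ∑ p, d p * d p := Finset.sum_nonneg fun p _ => mul_self_nonneg _
  have hD' : (∑ p, d p * d p) / Δt = 0 := by
    have := div_nonneg hD hΔt.le
    linarith
  have hD₀ : ∑ p, d p * d p = 0 := by simpa [hΔt.ne'] using hD'
  rw [Finset.sum_eq_zero_iff_of_nonneg fun p _ => mul_self_nonneg _] at hD₀
  exact mul_self_eq_zero.mp (hD₀ p (Finset.mem_univ p))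

/-- Well-balancing: the scheme exactly preserves the discrete geostrophic jet
steady state `u = 0`, `∂y h = ∂y v = ∂y b = 0`, `∂x φ − ω v = 0`. -/
theorem stmt_15 (Nx Ny : ℕ) [NeZero Nx] [NeZero Ny]
    (Δx Δy Δt g ω η : ℝ) (hΔx : 0 < Δx) (hΔy : 0 < Δy) (hΔt : 0 < Δt)
    (hg : 0 < g) (hη : 0 < η)
    (h0 h1 u0 u1 v0 v1 b q1 r1 : Grid Nx Ny)
    (hpos0 : ∀ p : Idx Nx Ny, 0 < h0 p)
    (φ0 φ1 : Grid Nx Ny)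
    (hφ0 : φ0 = fun p => g * (h0 p + b p))
    (hφ1 : φ1 = fun p => g * (h1 p + b p))
    (hq : q1 = fun p => η * Δt * (dX Δx φ1 p - ω * v0 p))
    (hr : r1 = fun p => η * Δt * (dY Δy φ1 p + ω * u0 p))
    (hs : Scheme Δx Δy Δt g ω h0 h1 u0 u1 v0 v1 b q1 r1)
    (hcflx : ∀ p : Idx Nx Ny, Δt / Δx * |u0 p| < 1/2)
    (hcfly : ∀ p : Idx Nx Ny, Δt / Δy * |v0 p| < 1/2)
    (hu0 : ∀ p : Idx Nx Ny, u0 p = 0)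
    (hhy : ∀ p : Idx Nx Ny, h0 (shYp p) = h0 p)
    (hvy : ∀ p : Idx Nx Ny, v0 (shYp p) = v0 p)
    (hby : ∀ p : Idx Nx Ny, b (shYp p) = b p)
    (hgeo : ∀ p : Idx Nx Ny, dX Δx φ0 p - ω * v0 p = 0) :
    (∀ p : Idx Nx Ny, h1 p = h0 p ∧ u1 p = 0 ∧ v1 p = v0 p)
    ∧ (∀ p : Idx Nx Ny, h1 (shYp p) = h1 p)
    ∧ (∀ p : Idx Nx Ny, v1 (shYp p) = v1 p)
    ∧ (∀ p : Idx Nx Ny, dX Δx φ1 p - ω * v1 p = 0) := by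
  subst hφ0 hφ1
  obtain ⟨hmass, hmomx, hmomy⟩ := hs
  have hhy' : ∀ p, h0 (shYm p) = h0 p := fun p => by simpa using (hhy (shYm p)).symm
  have hvy' : ∀ p, v0 (shYm p) = v0 p := fun p => by simpa using (hvy (shYm p)).symm
  have hby' : ∀ p, b (shYm p) = b p := fun p => by simpa using (hby (shYm p)).symm
  set d : Grid Nx Ny := fun p => h1 p - h0 p with hd
  have hq' : ∀ p, q1 p = η * Δt * g * dX Δx d p := fun p => by
    have := hgeo p
    simp only [hq, hd, dX] at this ⊢
    linear_combination η * Δt * this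
  have hr' : ∀ p, r1 p = η * Δt * g * dY Δy d p := fun p => by
    simp only [hr, hd, dY, hu0, hby, hby', hhy, hhy']
    ring
  have hd0 : ∀ p, d p = 0 := by
    refine eq_zero_of_advection_diffusion (Δx := Δx) (Δy := Δy) (c := η * Δt * g) hΔt
      (by positivity) hvy fun p => ?_
    have hm := hmass p
    simp only [fluxF, fluxG, avgX, avgY, hu0, hq', hr', shXp_shXm, shYp_shYm, hvy, hvy'] at hm
    rw [← hm]
    simp only [hd, dX, dY, shXp_shXm, shXm_shXp, shYp_shYm, shYm_shYp, hhy, hhy']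
    field_simp
    ring
  have hh : ∀ p, h1 p = h0 p := fun p => sub_eq_zero.mp (hd0 p)
  have hq0 : ∀ p, q1 p = 0 := fun p => by simp [hq', dX, hd0]
  have hr0 : ∀ p, r1 p = 0 := fun p => by simp [hr', dY, hd0]
  have hu1 : ∀ p, u1 p = 0 := fun p => by
    have hm := hmomx p
    have hgp := hgeo p
    simp only [upX, upY, hu0, hr0, hh, ite_self] at hm hgp
    have : h0 p * u1 p / Δt = 0 := by linear_combination hm - h0 p * hgp
    simpa [hΔt.ne', (hpos0 p).ne'] using this
  have hv1 : ∀ p, v1 p = v0 p := fun p => by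
    have hm := hmomy p
    simp only [fluxF, fluxG, avgX, avgY, upY, dY, hu0, hq0, hr0, hh, hhy, hhy', hvy, hvy',
      hby, hby', shYp_shYm, ite_self] at hm
    have : h0 p * (v1 p - v0 p) / Δt = 0 := by linear_combination hm
    simpa [hΔt.ne', (hpos0 p).ne', sub_eq_zero] using this
  refine ⟨fun p => ⟨hh p, hu1 p, hv1 p⟩, fun p => ?_, fun p => ?_, fun p => ?_⟩
  · rw [hh, hh, hhy]
  · rw [hv1, hv1, hvy]
  · simpa only [hh, hv1] using hgeo p
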